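/- arXiv:1203.2280 — 3 statements merged into one kernel-verified Lean document; each statement's English description precedes it below -/
import Mathlib

section
/- Let f : I ⊆ ℝ → ℝ be differentiable on the interior of I with a, b ∈ I, a < b, let α ≥ 1, and suppose f′ is integrable on [a,b]. Let w : [a,b] → [0,∞) be an integrable nonnegative weight with m(a,b) = ∫_a^b w(t) dt < ∞. Then the weighted Montgomery identity for Riemann–Liouville fractional integrals holds: m(a,b) f(x) = (b-x)^{1-α} Γ(α) J_a^α (w(b) f(b)) − J_a^{α-1} (Ω_w(x,b) f(b)) + J_a^α (Ω_w(x,b) f′(b)) for every x ∈ (a,b). -/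
open MeasureTheory intervalIntegral Set

/-- Riemann–Liouville fractional integral of order `β` with base point `a`,
evaluated at `x`: `J_a^β g (x) = (1/Γ(β)) ∫_a^x (x-t)^(β-1) g t dt`, with `J_a^0 g = g`. -/
noncomputable def RL (β a x : ℝ) (g : ℝ → ℝ) : ℝ :=
  if β = 0 then g x else (1 / Real.Gamma β) * ∫ t in a..x, (x - t) ^ (β - 1) * g t

/-- The weighted fractional Peano kernel `Ω_w(x, t)`. -/
noncomputable def Omega (a b x α : ℝ) (w : ℝ → ℝ) (t : ℝ) : ℝ :=
  if t < x then (b - x) ^ (1 - α) * Real.Gamma α * ∫ u in a..t, w u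
  else (b - x) ^ (1 - α) * Real.Gamma α * ∫ u in b..t, w u

/-- `F` is a primitive on `[c, d]` of the integrable function `f`. -/
structure IsPrimitiveOn (F f : ℝ → ℝ) (c d : ℝ) : Prop where
  intervalIntegrable : IntervalIntegrable f volume c d
  integral_eq : ∀ s ∈ Icc c d, ∀ t ∈ Icc c d, ∫ u in s..t, f u = F t - F s

namespace IsPrimitiveOn

variable {F G f g : ℝ → ℝ} {c d : ℝ}

theorem mono (hF : IsPrimitiveOn F f c d) {c' d' : ℝ} (hc : c ≤ c') (hcd : c' ≤ d')
    (hd : d' ≤ d) : IsPrimitiveOn F f c' d' where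
  intervalIntegrable := hF.intervalIntegrable.mono_set <| by
    rw [uIcc_of_le hcd, uIcc_of_le (hc.trans (hcd.trans hd))]
    exact Icc_subset_Icc hc hd
  integral_eq s hs t ht :=
    hF.integral_eq s (Icc_subset_Icc hc hd hs) t (Icc_subset_Icc hc hd ht)

theorem of_integral (hf : IntervalIntegrable f volume c d) {p : ℝ} (hp : p ∈ Icc c d) (C : ℝ) :
    IsPrimitiveOn (fun t => C + ∫ u in p..t, f u) f c d where
  intervalIntegrable := hf
  integral_eq s hs t ht := by
    have hcd : c ≤ d := hp.1.trans hp.2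
    have key : ∀ r ∈ Icc c d, IntervalIntegrable f volume p r := fun r hr =>
      hf.mono_set (by rw [uIcc_of_le hcd]; exact ordConnected_Icc.uIcc_subset hp hr)
    rw [add_sub_add_left_eq_sub, integral_interval_sub_left (key t ht) (key s hs)]

/-- A primitive agrees on `[c, d]` with an absolutely continuous function whose derivative is
almost everywhere `f`. -/
theorem exists_absolutelyContinuous (hcd : c ≤ d) (hF : IsPrimitiveOn F f c d) :
    ∃ H : ℝ → ℝ, AbsolutelyContinuousOnInterval H c d ∧ EqOn H F (Icc c d) ∧
      ∀ᵐ t, t ∈ Icc c d → HasDerivAt H (f t) t := by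
  have hc : c ∈ Icc c d := left_mem_Icc.2 hcd
  refine ⟨fun t => F c + ∫ u in c..t, f u, ?_, fun t ht => ?_, ?_⟩
  · have h0 : AbsolutelyContinuousOnInterval (fun _ : ℝ => F c) c d :=
      contDiffOn_const.absolutelyContinuousOnInterval
    exact h0.add (hF.intervalIntegrable.absolutelyContinuousOnInterval_intervalIntegral
      (c := c) left_mem_uIcc)
  · simp [hF.integral_eq c hc t ht]
  · filter_upwards [hF.intervalIntegrable.ae_hasDerivAt_integral] with t ht hmem
    rw [← uIcc_of_le hcd] at hmem
    exact (ht hmem c left_mem_uIcc).const_add (F c)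

theorem continuousOn (hcd : c ≤ d) (hF : IsPrimitiveOn F f c d) : ContinuousOn F (Icc c d) := by
  obtain ⟨H, hH, hHF, -⟩ := hF.exists_absolutelyContinuous hcd
  have := hH.continuousOn
  rw [uIcc_of_le hcd] at this
  exact this.congr hHF.symm

theorem mul (hcd : c ≤ d) (hF : IsPrimitiveOn F f c d) (hG : IsPrimitiveOn G g c d) :
    IsPrimitiveOn (fun t => F t * G t) (fun t => f t * G t + F t * g t) c d where
  intervalIntegrable := by
    refine (hF.intervalIntegrable.mul_continuousOn ?_).add
      (hG.intervalIntegrable.continuousOn_mul ?_) <;> rw [uIcc_of_le hcd]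
    exacts [hG.continuousOn hcd, hF.continuousOn hcd]
  integral_eq s hs t ht := by
    obtain ⟨H, hH, hHF, hHd⟩ := hF.exists_absolutelyContinuous hcd
    obtain ⟨K, hK, hKG, hKd⟩ := hG.exists_absolutelyContinuous hcd
    have hst : uIcc s t ⊆ uIcc c d := by
      rw [uIcc_of_le hcd]; exact ordConnected_Icc.uIcc_subset hs ht
    have := (hH.mono hst).integral_deriv_mul_eq_sub (hK.mono hst)
    rw [hHF ht, hHF hs, hKG ht, hKG hs] at this
    rw [← this]
    apply intervalIntegral.integral_congr_ae
    filter_upwards [hHd, hKd] with u hu hu' hmem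
    have hu0 : u ∈ Icc c d := by rw [← uIcc_of_le hcd]; exact hst (uIoc_subset_uIcc hmem)
    rw [(hu hu0).deriv, (hu' hu0).deriv, hHF hu0, hKG hu0]

/-- Integration by parts for a product of three primitives. -/
theorem integral_mul_mul {K k : ℝ → ℝ} (hcd : c ≤ d) (hK : IsPrimitiveOn K k c d)
    (hF : IsPrimitiveOn F f c d) (hG : IsPrimitiveOn G g c d) :
    (∫ t in c..d, (k t * F t) * G t) + (∫ t in c..d, K t * (g t * F t))
      + (∫ t in c..d, (K t * f t) * G t) = K d * F d * G d - K c * F c * G c := by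
  have cK := hK.continuousOn hcd
  have cF := hF.continuousOn hcd
  have cG := hG.continuousOn hcd
  rw [← uIcc_of_le hcd] at cK cF cG
  rw [← ((hK.mul hcd hF).mul hcd hG).integral_eq c (left_mem_Icc.2 hcd) d (right_mem_Icc.2 hcd),
    ← intervalIntegral.integral_add, ← intervalIntegral.integral_add]
  · congr 1; ext t; ring
  · exact ((hK.intervalIntegrable.mul_continuousOn cF).mul_continuousOn cG).add
      ((hG.intervalIntegrable.mul_continuousOn cF).continuousOn_mul cK)
  · exact (hF.intervalIntegrable.continuousOn_mul cK).mul_continuousOn cG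
  · exact (hK.intervalIntegrable.mul_continuousOn cF).mul_continuousOn cG
  · exact (hG.intervalIntegrable.mul_continuousOn cF).continuousOn_mul cK

/-- The power `(b - t) ^ (α - 1)` is a primitive on `[a, b]`, even where its derivative is
unbounded at `b`. -/
theorem sub_rpow {a b α : ℝ} (hab : a ≤ b) (hα : 1 ≤ α) :
    IsPrimitiveOn (fun t => (b - t) ^ (α - 1)) (fun t => -((α - 1) * (b - t) ^ (α - 1 - 1)))
      a b := by
  have hint : IntervalIntegrable (fun t => -((α - 1) * (b - t) ^ (α - 1 - 1))) volume a b := by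
    rcases hα.eq_or_lt with rfl | hα
    · simp
    · have := (intervalIntegrable_rpow' (a := b - a) (b := b - b) (r := α - 1 - 1)
        (by linarith)).comp_sub_left b
      simp only [sub_sub_cancel] at this
      exact (this.const_mul _).neg
  have hcont : Continuous fun t : ℝ => (b - t) ^ (α - 1) :=
    (continuous_const.sub continuous_id).rpow_const fun _ => Or.inr (by linarith)
  have key : ∀ s ∈ Icc a b, ∀ t ∈ Icc a b, s ≤ t →
      ∫ u in s..t, -((α - 1) * (b - u) ^ (α - 1 - 1)) = (b - t) ^ (α - 1) - (b - s) ^ (α - 1) := by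
    intro s hs t ht hst
    refine integral_eq_sub_of_hasDerivAt_of_le hst hcont.continuousOn (fun u hu => ?_)
      (hint.mono_set ?_)
    · have hne : b - u ≠ 0 := by linarith [hu.2, ht.2]
      have := ((hasDerivAt_id' u).const_sub b).rpow_const (p := α - 1) (Or.inl hne)
      rwa [neg_one_mul, neg_mul] at this
    · rw [uIcc_of_le hab]; exact ordConnected_Icc.uIcc_subset hs ht
  refine ⟨hint, fun s hs t ht => ?_⟩
  rcases le_total s t with hst | hst
  · exact key s hs t ht hst
  · rw [integral_symm, key t ht s hs hst, neg_sub]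

end IsPrimitiveOn

/-- The integral of `h` against the fractional Peano kernel, split at the jump of the kernel. -/
theorem integral_mul_Omega {a b x α : ℝ} {w h : ℝ → ℝ} (hx : x ∈ Ioo a b)
    (hw : IntervalIntegrable w volume a b) (hh : IntervalIntegrable h volume a b) :
    ∫ t in a..b, h t * Omega a b x α w t = (b - x) ^ (1 - α) * Real.Gamma α *
      ((∫ t in a..x, h t * ∫ u in a..t, w u) + ∫ t in x..b, h t * ∫ u in b..t, w u) := by
  have hab : a ≤ b := (hx.1.trans hx.2).le
  have hprim : ∀ p ∈ Icc a b, ContinuousOn (fun t => ∫ u in p..t, w u) (Icc a b) := fun p hp => by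
    simpa using (IsPrimitiveOn.of_integral hw hp 0).continuousOn hab
  have hax : uIcc a x ⊆ Icc a b := by
    rw [uIcc_of_le hx.1.le]; exact Icc_subset_Icc le_rfl hx.2.le
  have hxb : uIcc x b ⊆ Icc a b := by
    rw [uIcc_of_le hx.2.le]; exact Icc_subset_Icc hx.1.le le_rfl
  have eL : EqOn (fun t => (b - x) ^ (1 - α) * Real.Gamma α * (h t * ∫ u in a..t, w u))
      (fun t => h t * Omega a b x α w t) (uIoo a x) := fun t ht => by
    rw [uIoo_of_le hx.1.le] at ht
    simp only [Omega, if_pos ht.2]; ring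
  have eR : EqOn (fun t => (b - x) ^ (1 - α) * Real.Gamma α * (h t * ∫ u in b..t, w u))
      (fun t => h t * Omega a b x α w t) (uIoo x b) := fun t ht => by
    rw [uIoo_of_le hx.2.le] at ht
    simp only [Omega, if_neg ht.1.not_gt]; ring
  have iL : IntervalIntegrable (fun t => h t * ∫ u in a..t, w u) volume a x :=
    (hh.mono_set (by rwa [uIcc_of_le hab])).mul_continuousOn
      ((hprim a (left_mem_Icc.2 hab)).mono hax)
  have iR : IntervalIntegrable (fun t => h t * ∫ u in b..t, w u) volume x b :=
    (hh.mono_set (by rwa [uIcc_of_le hab])).mul_continuousOn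
      ((hprim b (right_mem_Icc.2 hab)).mono hxb)
  rw [← integral_add_adjacent_intervals ((iL.const_mul _).congr_uIoo eL)
    ((iR.const_mul _).congr_uIoo eR), ← integral_congr_uIoo eL, ← integral_congr_uIoo eR,
    intervalIntegral.integral_const_mul, intervalIntegral.integral_const_mul, mul_add]

/-- A function with integrable derivative on `(a, b)` agrees there with a primitive of that
derivative on `[a, b]`. -/
theorem exists_isPrimitiveOn_of_hasDerivAt {a b : ℝ} {f f' : ℝ → ℝ} (hab : a < b)
    (hf : ∀ y ∈ Ioo a b, HasDerivAt f (f' y) y) (hf' : IntervalIntegrable f' volume a b) :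
    ∃ F : ℝ → ℝ, IsPrimitiveOn F f' a b ∧ EqOn f F (Ioo a b) := by
  obtain ⟨x, hx⟩ := exists_between hab
  refine ⟨_, .of_integral hf' (Ioo_subset_Icc_self hx) (f x), fun t ht => ?_⟩
  have hsub : uIcc x t ⊆ Ioo a b := ordConnected_Ioo.uIcc_subset hx ht
  have : ∫ u in x..t, f' u = f t - f x :=
    integral_eq_sub_of_hasDerivAt (fun u hu => hf u (hsub hu))
      (hf'.mono_set (by rw [uIcc_of_le hab.le]; exact hsub.trans Ioo_subset_Icc_self))
  simp [this]

theorem RL_Omega_mul {a b x α : ℝ} {w g : ℝ → ℝ} (hx : x ∈ Ioo a b) (hα : 1 ≤ α) :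
    RL (α - 1) a b (fun t => Omega a b x α w t * g t)
      = (Real.Gamma α)⁻¹ *
        ∫ t in a..b, (α - 1) * (b - t) ^ (α - 1 - 1) * g t * Omega a b x α w t := by
  rcases hα.eq_or_lt with rfl | hα
  · simp [RL, Omega, hx.2.not_gt]
  · have h0 : α - 1 ≠ 0 := by linarith
    have hG : Real.Gamma α = (α - 1) * Real.Gamma (α - 1) := by
      simpa using Real.Gamma_add_one h0
    have hG0 : Real.Gamma (α - 1) ≠ 0 := (Real.Gamma_pos_of_pos (by linarith)).ne'
    rw [RL, if_neg h0, hG, show (fun t => (α - 1) * (b - t) ^ (α - 1 - 1) * g t *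
      Omega a b x α w t) = fun t => (α - 1) * ((b - t) ^ (α - 1 - 1) *
      (Omega a b x α w t * g t)) by ext t; ring, intervalIntegral.integral_const_mul]
    field_simp

/-- Weighted Montgomery identity for Riemann–Liouville fractional integrals. -/
theorem weighted_montgomery_identity
    (I : Set ℝ) (hI : I.OrdConnected) (a b x α : ℝ) (f f' w : ℝ → ℝ)
    (ha : a ∈ I) (hb : b ∈ I) (hab : a < b) (hα : 1 ≤ α)
    (hf : ∀ y ∈ interior I, HasDerivAt f (f' y) y)
    (hf' : IntervalIntegrable f' volume a b)
    (hw0 : ∀ t ∈ Set.Icc a b, 0 ≤ w t)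
    (hw : IntervalIntegrable w volume a b)
    (hx : x ∈ Set.Ioo a b) :
    (∫ t in a..b, w t) * f x
      = (b - x) ^ (1 - α) * Real.Gamma α * RL α a b (fun t => w t * f t)
        - RL (α - 1) a b (fun t => Omega a b x α w t * f t)
        + RL α a b (fun t => Omega a b x α w t * f' t) := by
  have hab' : a ≤ b := hab.le
  have hx' : x ∈ uIcc a b := by rw [uIcc_of_le hab']; exact Ioo_subset_Icc_self hx
  have hint : Ioo a b ⊆ interior I :=
    interior_maximal (Ioo_subset_Icc_self.trans (hI.out ha hb)) isOpen_Ioo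
  obtain ⟨F, hF, hfF⟩ := exists_isPrimitiveOn_of_hasDerivAt hab (fun y hy => hf y (hint hy)) hf'
  have hK := IsPrimitiveOn.sub_rpow hab' hα
  have hA : IsPrimitiveOn (fun t => ∫ u in a..t, w u) w a b := by
    simpa using IsPrimitiveOn.of_integral hw (left_mem_Icc.2 hab') 0
  have hB : IsPrimitiveOn (fun t => ∫ u in b..t, w u) w a b := by
    simpa using IsPrimitiveOn.of_integral hw (right_mem_Icc.2 hab') 0
  have cK := hK.continuousOn hab'
  have cF := hF.continuousOn hab'
  rw [← uIcc_of_le hab'] at cK cF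
  have partsL := (hK.mono le_rfl hx.1.le hx.2.le).integral_mul_mul hx.1.le
    (hF.mono le_rfl hx.1.le hx.2.le) (hA.mono le_rfl hx.1.le hx.2.le)
  have partsR := (hK.mono hx.1.le hx.2.le le_rfl).integral_mul_mul hx.2.le
    (hF.mono hx.1.le hx.2.le le_rfl) (hB.mono hx.1.le hx.2.le le_rfl)
  have split1 := integral_mul_Omega (α := α) hx hw (hK.intervalIntegrable.mul_continuousOn cF)
  have split2 := integral_mul_Omega (α := α) hx hw (hF.intervalIntegrable.continuousOn_mul cK)
  have hwF : IntervalIntegrable (fun t => (b - t) ^ (α - 1) * (w t * F t)) volume a b :=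
    (hw.mul_continuousOn cF).continuousOn_mul cK
  have split3 := integral_add_adjacent_intervals
    (hwF.mono_set (uIcc_subset_uIcc_left hx'))
    (hwF.mono_set (uIcc_subset_uIcc_right hx'))
  have hmass : (∫ u in a..x, w u) - (∫ u in b..x, w u) = ∫ u in a..b, w u := by
    rw [integral_symm x b, sub_neg_eq_add]
    exact integral_add_adjacent_intervals (hA.mono le_rfl hx.1.le hx.2.le).intervalIntegrable
      (hA.mono hx.1.le hx.2.le le_rfl).intervalIntegrable
  have e1 : RL α a b (fun t => w t * f t)
      = (Real.Gamma α)⁻¹ * ∫ t in a..b, (b - t) ^ (α - 1) * (w t * F t) := by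
    rw [RL, if_neg (by linarith), one_div]
    congr 1
    exact integral_congr_Ioo_of_le hab' fun t ht => by simp only [hfF ht]
  have e2 : RL (α - 1) a b (fun t => Omega a b x α w t * f t) = -((Real.Gamma α)⁻¹ *
      ∫ t in a..b, -((α - 1) * (b - t) ^ (α - 1 - 1)) * F t * Omega a b x α w t) := by
    rw [RL_Omega_mul hx hα, ← mul_neg, ← intervalIntegral.integral_neg]
    congr 1
    exact integral_congr_Ioo_of_le hab' fun t ht => by simp only [hfF ht]; ring
  have e3 : RL α a b (fun t => Omega a b x α w t * f' t) = (Real.Gamma α)⁻¹ *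
      ∫ t in a..b, (b - t) ^ (α - 1) * f' t * Omega a b x α w t := by
    rw [RL, if_neg (by linarith), one_div]
    congr 2
    ext t; ring
  have hpow : (b - x) ^ (1 - α) * (b - x) ^ (α - 1) = 1 := by
    rw [← Real.rpow_add (sub_pos.2 hx.2)]; simp
  have hG : Real.Gamma α ≠ 0 := (Real.Gamma_pos_of_pos (by linarith)).ne'
  have cancel (T : ℝ) :
      (Real.Gamma α)⁻¹ * ((b - x) ^ (1 - α) * Real.Gamma α * T) = (b - x) ^ (1 - α) * T := by
    field_simp
  have cancel' (T : ℝ) :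
      (b - x) ^ (1 - α) * Real.Gamma α * ((Real.Gamma α)⁻¹ * T) = (b - x) ^ (1 - α) * T := by
    field_simp
  rw [e1, e2, e3, split1, split2, cancel, cancel, cancel', ← split3, ← hmass, hfF hx]
  simp only [integral_same, mul_zero, sub_zero, zero_sub] at partsL partsR
  linear_combination (-((∫ u in a..x, w u) - ∫ u in b..x, w u) * F x) * hpow
    - (b - x) ^ (1 - α) * (partsL + partsR)
end

section
/- Let f : I ⊆ ℝ → ℝ be differentiable on the interior of I with a, b ∈ I, a < b, α ≥ 1, and f′ integrable on [a,b]. Then the fractional Montgomery identity holds: f(x) = (Γ(α)/(b-a)) (b-x)^{1-α} J_a^α f(b) − J_a^{α-1} (P₂(x,b) f(b)) + J_a^α (P₂(x,b) f′(b)) for every x ∈ (a,b). -/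
open MeasureTheory intervalIntegral Set

/-- The fractional Peano kernel `P₂(x, t)`. -/
noncomputable def P2 (a b x α : ℝ) (t : ℝ) : ℝ :=
  if t < x then (t - a) / (b - a) * ((b - x) ^ (1 - α) * Real.Gamma α)
  else (t - b) / (b - a) * ((b - x) ^ (1 - α) * Real.Gamma α)

/-- A function differentiable on `(a, b)` with integrable derivative agrees on `(a, b)` with a
function continuous on `[a, b]`. -/
theorem exists_continuousOn_Icc_eqOn_Ioo {a b x : ℝ} {f f' : ℝ → ℝ} (hx : x ∈ Ioo a b)
    (hf : ∀ y ∈ Ioo a b, HasDerivAt f (f' y) y) (hf' : IntervalIntegrable f' volume a b) :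
    ∃ F : ℝ → ℝ, ContinuousOn F (Icc a b) ∧ EqOn F f (Ioo a b) := by
  have hab : a ≤ b := (hx.1.trans hx.2).le
  refine ⟨fun t => f x + ∫ s in x..t, f' s, ?_, fun t ht => ?_⟩
  · have h := continuousOn_primitive_interval' hf'
      (show x ∈ uIcc a b by rw [uIcc_of_le hab]; exact Ioo_subset_Icc_self hx)
    rw [uIcc_of_le hab] at h
    exact continuousOn_const.add h
  · have hsub : uIcc x t ⊆ Ioo a b := ordConnected_Ioo.uIcc_subset hx ht
    have h := integral_eq_sub_of_hasDerivAt (fun y hy => hf y (hsub hy))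
      (hf'.mono_set (by rw [uIcc_of_le hab]; exact hsub.trans Ioo_subset_Icc_self))
    simp [h]

/-- Integration by parts for `w * f`, with the three resulting integrands prescribed only in the
interior of the interval. -/
theorem integration_by_parts_of_eqOn_Ioo {p q β : ℝ} {f f' F w v u h₁ h₂ h₃ : ℝ → ℝ} (hpq : p ≤ q)
    (hF : ContinuousOn F (Icc p q)) (hFf : EqOn F f (Ioo p q))
    (hf : ∀ y ∈ Ioo p q, HasDerivAt f (f' y) y) (hf' : IntervalIntegrable f' volume p q)
    (hw : ContinuousOn w (Icc p q)) (hv : ContinuousOn v (Icc p q)) (hu : ContinuousOn u (Icc p q))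
    (hw' : ∀ y ∈ Ioo p q, HasDerivAt w (u y - β * v y) y)
    (e₁ : ∀ y ∈ Ioo p q, h₁ y = u y * f y) (e₂ : ∀ y ∈ Ioo p q, h₂ y = v y * f y)
    (e₃ : ∀ y ∈ Ioo p q, h₃ y = w y * f' y) :
    IntervalIntegrable h₁ volume p q ∧ IntervalIntegrable h₂ volume p q ∧
      IntervalIntegrable h₃ volume p q ∧
      (∫ t in p..q, h₁ t) - β * (∫ t in p..q, h₂ t) + (∫ t in p..q, h₃ t)
        = w q * F q - w p * F p := by
  have hIoo : uIoo p q = Ioo p q := uIoo_of_le hpq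
  have E₁ : EqOn (fun y => u y * F y) h₁ (uIoo p q) := by
    intro y hy
    rw [hIoo] at hy
    simp only [e₁ y hy, hFf hy]
  have E₂ : EqOn (fun y => v y * F y) h₂ (uIoo p q) := by
    intro y hy
    rw [hIoo] at hy
    simp only [e₂ y hy, hFf hy]
  have E₃ : EqOn (fun y => w y * f' y) h₃ (uIoo p q) := by
    intro y hy
    rw [hIoo] at hy
    simp only [e₃ y hy]
  have i₁ : IntervalIntegrable (fun y => u y * F y) volume p q :=
    (hu.mul hF).intervalIntegrable_of_Icc hpq
  have i₂ : IntervalIntegrable (fun y => v y * F y) volume p q :=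
    (hv.mul hF).intervalIntegrable_of_Icc hpq
  have i₃ : IntervalIntegrable (fun y => w y * f' y) volume p q :=
    hf'.continuousOn_mul (by rwa [uIcc_of_le hpq])
  refine ⟨i₁.congr_uIoo E₁, i₂.congr_uIoo E₂, i₃.congr_uIoo E₃, ?_⟩
  rw [← integral_congr_uIoo E₁, ← integral_congr_uIoo E₂, ← integral_congr_uIoo E₃,
    ← intervalIntegral.integral_const_mul, ← integral_sub i₁ (i₂.const_mul β),
    ← integral_add (i₁.sub (i₂.const_mul β)) i₃]
  refine integral_eq_sub_of_hasDerivAt_of_le (f := fun y => w y * F y) hpq (hw.mul hF)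
    (fun y hy => ?_) ((i₁.sub (i₂.const_mul β)).add i₃)
  have hFy : HasDerivAt F (f' y) y :=
    (hf y hy).congr_of_eventuallyEq (hFf.eventuallyEq_of_mem (Ioo_mem_nhds hy.1 hy.2))
  exact ((hw' y hy).mul hFy).congr_deriv (by ring)

theorem hasDerivAt_rpow_sub_mul {b c t β : ℝ} (ht : t < b) :
    HasDerivAt (fun s => (b - s) ^ β * (s - c))
      ((b - t) ^ β - β * ((b - t) ^ (β - 1) * (t - c))) t := by
  have h₁ : HasDerivAt (fun s : ℝ => (b - s) ^ β) (-1 * β * (b - t) ^ (β - 1)) t :=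
    ((hasDerivAt_id t).const_sub b).rpow_const (Or.inl (sub_pos.2 ht).ne')
  exact (h₁.mul ((hasDerivAt_id t).sub_const c)).congr_deriv (by simp; ring)

/-- The unnormalised Montgomery identity, with `β = α - 1`. -/
theorem integral_rpow_montgomery {a b x β : ℝ} {f f' : ℝ → ℝ} (hβ : 0 ≤ β)
    (hf : ∀ y ∈ Ioo a b, HasDerivAt f (f' y) y) (hf' : IntervalIntegrable f' volume a b)
    (hx : x ∈ Ioo a b) :
    (∫ t in a..b, (b - t) ^ β * f t)
      - β * (∫ t in a..b, (b - t) ^ (β - 1) * ((if t < x then t - a else t - b) * f t))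
      + (∫ t in a..b, (b - t) ^ β * ((if t < x then t - a else t - b) * f' t))
      = (b - x) ^ β * (b - a) * f x := by
  obtain ⟨F, hF, hFf⟩ := exists_continuousOn_Icc_eqOn_Ioo hx hf hf'
  have hab : a ≤ b := (hx.1.trans hx.2).le
  have hu : Continuous fun t : ℝ => (b - t) ^ β :=
    (continuous_const.sub continuous_id).rpow_const fun _ => Or.inr hβ
  have hl : Ioo a x ⊆ Ioo a b := Ioo_subset_Ioo_right hx.2.le
  have hr : Ioo x b ⊆ Ioo a b := Ioo_subset_Ioo_left hx.1.le
  have key {t : ℝ} (ht : t < b) : (b - t) ^ (β - 1) * (t - b) = -(b - t) ^ β := by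
    rw [Real.rpow_sub_one (sub_pos.2 ht).ne']
    have := (sub_pos.2 ht).ne'
    field_simp
    ring
  obtain ⟨l₁, l₂, l₃, hleft⟩ := integration_by_parts_of_eqOn_Ioo (β := β)
    (w := fun t => (b - t) ^ β * (t - a)) (v := fun t => (b - t) ^ (β - 1) * (t - a))
    (u := fun t => (b - t) ^ β) (f := f) (f' := f') (F := F)
    (h₁ := fun t => (b - t) ^ β * f t)
    (h₂ := fun t => (b - t) ^ (β - 1) * ((if t < x then t - a else t - b) * f t))
    (h₃ := fun t => (b - t) ^ β * ((if t < x then t - a else t - b) * f' t))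
    hx.1.le (hF.mono (Icc_subset_Icc_right hx.2.le)) (hFf.mono hl) (fun y hy => hf y (hl hy))
    (hf'.mono_set (by
      rw [uIcc_of_le hab, uIcc_of_le hx.1.le]; exact Icc_subset_Icc_right hx.2.le))
    (hu.mul (continuous_id.sub continuous_const)).continuousOn
    (((continuous_const.sub continuous_id).continuousOn.rpow_const fun t ht =>
      Or.inl (sub_pos.2 (ht.2.trans_lt hx.2)).ne').mul
        (continuous_id.sub continuous_const).continuousOn)
    hu.continuousOn (fun y hy => hasDerivAt_rpow_sub_mul (hy.2.trans hx.2))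
    (fun y _ => rfl) (fun y hy => by simp only [if_pos hy.2]; ring)
    (fun y hy => by simp only [if_pos hy.2]; ring)
  obtain ⟨r₁, r₂, r₃, hright⟩ := integration_by_parts_of_eqOn_Ioo (β := β)
    (w := fun t => (b - t) ^ β * (t - b)) (v := fun t => -(b - t) ^ β)
    (u := fun t => (b - t) ^ β) (f := f) (f' := f') (F := F)
    (h₁ := fun t => (b - t) ^ β * f t)
    (h₂ := fun t => (b - t) ^ (β - 1) * ((if t < x then t - a else t - b) * f t))
    (h₃ := fun t => (b - t) ^ β * ((if t < x then t - a else t - b) * f' t))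
    hx.2.le (hF.mono (Icc_subset_Icc_left hx.1.le)) (hFf.mono hr) (fun y hy => hf y (hr hy))
    (hf'.mono_set (by
      rw [uIcc_of_le hab, uIcc_of_le hx.2.le]; exact Icc_subset_Icc_left hx.1.le))
    (hu.mul (continuous_id.sub continuous_const)).continuousOn
    hu.neg.continuousOn
    hu.continuousOn
    (fun y hy => (hasDerivAt_rpow_sub_mul (c := b) hy.2).congr_deriv (by rw [key hy.2]))
    (fun y _ => rfl)
    (fun y hy => by simp only [if_neg hy.1.not_gt]; rw [← mul_assoc, key hy.2])
    (fun y hy => by simp only [if_neg hy.1.not_gt]; ring)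
  rw [← integral_add_adjacent_intervals l₁ r₁, ← integral_add_adjacent_intervals l₂ r₂,
    ← integral_add_adjacent_intervals l₃ r₃, ← hFf hx]
  simp only [sub_self, mul_zero, zero_mul] at hleft hright
  linear_combination hleft + hright

theorem P2_eq (a b x α t : ℝ) :
    P2 a b x α t = (b - x) ^ (1 - α) * Real.Gamma α / (b - a)
      * (if t < x then t - a else t - b) := by
  unfold P2
  split_ifs <;> ring

theorem RL_P2_mul (β a b x α : ℝ) (hβ : β ≠ 0) (g : ℝ → ℝ) :
    RL β a b (fun t => P2 a b x α t * g t) =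
      (b - x) ^ (1 - α) * Real.Gamma α / (b - a) * (1 / Real.Gamma β *
        ∫ t in a..b, (b - t) ^ (β - 1) * ((if t < x then t - a else t - b) * g t)) := by
  rw [RL, if_neg hβ, mul_left_comm]
  congr 1
  rw [← intervalIntegral.integral_const_mul]
  refine intervalIntegral.integral_congr fun t _ => ?_
  simp only [P2_eq]
  ring

/-- Montgomery identity for Riemann–Liouville fractional integrals. -/
theorem fractional_montgomery_identity
    (I : Set ℝ) (hI : I.OrdConnected) (a b x α : ℝ) (f f' : ℝ → ℝ)
    (ha : a ∈ I) (hb : b ∈ I) (hab : a < b) (hα : 1 ≤ α)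
    (hf : ∀ y ∈ interior I, HasDerivAt f (f' y) y)
    (hf' : IntervalIntegrable f' volume a b)
    (hx : x ∈ Set.Ioo a b) :
    f x = Real.Gamma α / (b - a) * (b - x) ^ (1 - α) * RL α a b f
        - RL (α - 1) a b (fun t => P2 a b x α t * f t)
        + RL α a b (fun t => P2 a b x α t * f' t) := by
  have hsub : Ioo a b ⊆ interior I :=
    interior_maximal (Ioo_subset_Icc_self.trans (hI.out ha hb)) isOpen_Ioo
  have main := integral_rpow_montgomery (sub_nonneg.2 hα) (fun y hy => hf y (hsub hy)) hf' hx
  have hα0 : α ≠ 0 := by linarith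
  have hΓ : Real.Gamma α ≠ 0 := (Real.Gamma_pos_of_pos (by linarith)).ne'
  have hba : b - a ≠ 0 := (sub_pos.2 hab).ne'
  have hbx : (b - x) ^ (1 - α) * (b - x) ^ (α - 1) = 1 := by
    rw [← Real.rpow_add (sub_pos.2 hx.2)]
    simp
  have hmid : RL (α - 1) a b (fun t => P2 a b x α t * f t) =
      (b - x) ^ (1 - α) / (b - a) * ((α - 1) *
        ∫ t in a..b, (b - t) ^ (α - 1 - 1) * ((if t < x then t - a else t - b) * f t)) := by
    rcases eq_or_ne (α - 1) 0 with h | h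
    · simp [RL, h, P2_eq, hx.2.not_gt]
    · have hΓ' : Real.Gamma (α - 1) ≠ 0 :=
        (Real.Gamma_pos_of_pos (lt_of_le_of_ne (sub_nonneg.2 hα) h.symm)).ne'
      have hrec : Real.Gamma α = (α - 1) * Real.Gamma (α - 1) := by
        simpa using Real.Gamma_add_one h
      rw [RL_P2_mul _ _ _ _ _ h, hrec]
      field_simp
  rw [hmid, RL_P2_mul _ _ _ _ _ hα0, RL, if_neg hα0]
  have hfx : f x = (b - x) ^ (1 - α) / (b - a) * ((b - x) ^ (α - 1) * (b - a) * f x) := by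
    field_simp
    linear_combination (-f x) * hbx
  rw [hfx, ← main]
  field_simp
end

section
/- If f : [a,b] → ℝ is a differentiable function with bounded derivative, i.e. |f′(t)| ≤ ‖f′‖_∞ for all t ∈ [a,b], then for every x ∈ [a,b]: |f(x) − (1/(b-a)) ∫_a^b f(t) dt| ≤ [1/4 + (x − (a+b)/2)²/(b-a)²] (b-a) ‖f′‖_∞. -/
open MeasureTheory intervalIntegral Set

theorem integral_abs_sub_eq {a b x : ℝ} (hx : x ∈ Set.Icc a b) :
    ∫ t in a..b, |x - t| = ((x - a) ^ 2 + (b - x) ^ 2) / 2 := by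
  have hint (c d : ℝ) : IntervalIntegrable (fun t : ℝ => |x - t|) volume c d :=
    (by fun_prop : Continuous fun t : ℝ => |x - t|).intervalIntegrable c d
  have hleft : ∫ t in a..x, |x - t| = ∫ t in a..x, (x - t) := by
    refine intervalIntegral.integral_congr fun t ht => ?_
    rw [Set.uIcc_of_le hx.1] at ht
    exact abs_of_nonneg (sub_nonneg.2 ht.2)
  have hright : ∫ t in x..b, |x - t| = ∫ t in x..b, (t - x) := by
    refine intervalIntegral.integral_congr fun t ht => ?_
    rw [Set.uIcc_of_le hx.2] at ht
    exact (abs_sub_comm x t).trans (abs_of_nonneg (sub_nonneg.2 ht.1))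
  rw [← intervalIntegral.integral_add_adjacent_intervals (hint a x) (hint x b), hleft, hright,
    intervalIntegral.integral_sub (by simp) (by simp),
    intervalIntegral.integral_sub (by simp) (by simp)]
  simp only [intervalIntegral.integral_const, integral_id, smul_eq_mul]
  ring

/-- The classical Ostrowski inequality. -/
theorem ostrowski_inequality
    (a b x M : ℝ) (f f' : ℝ → ℝ) (hab : a < b)
    (hf : ∀ t ∈ Set.Icc a b, HasDerivWithinAt f (f' t) (Set.Icc a b) t)
    (hM : ∀ t ∈ Set.Icc a b, |f' t| ≤ M)
    (hx : x ∈ Set.Icc a b) :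
    |f x - (1 / (b - a)) * ∫ t in a..b, f t|
      ≤ (1 / 4 + (x - (a + b) / 2) ^ 2 / (b - a) ^ 2) * (b - a) * M := by
  have hL : 0 < b - a := sub_pos.2 hab
  have hfi : IntervalIntegrable f volume a b :=
    ContinuousOn.intervalIntegrable_of_Icc hab.le fun t ht => (hf t ht).continuousWithinAt
  have hlip : ∀ t ∈ Set.Icc a b, ‖f x - f t‖ ≤ M * |x - t| := fun t ht =>
    (convex_Icc a b).norm_image_sub_le_of_norm_hasDerivWithin_le hf hM ht hx
  have hmean : f x - (1 / (b - a)) * ∫ t in a..b, f t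
      = (∫ t in a..b, (f x - f t)) / (b - a) := by
    rw [intervalIntegral.integral_sub (by simp) hfi, intervalIntegral.integral_const, smul_eq_mul]
    field_simp
  have hbound : |∫ t in a..b, (f x - f t)| ≤ M * (((x - a) ^ 2 + (b - x) ^ 2) / 2) := by
    rw [← integral_abs_sub_eq hx, ← intervalIntegral.integral_const_mul]
    refine intervalIntegral.norm_integral_le_of_norm_le hab.le
      (ae_of_all _ fun t ht => hlip t (Set.Ioc_subset_Icc_self ht)) ?_
    exact (by fun_prop : Continuous fun t : ℝ => M * |x - t|).intervalIntegrable a b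
  rw [hmean, abs_div, abs_of_pos hL]
  calc |∫ t in a..b, (f x - f t)| / (b - a)
      ≤ M * (((x - a) ^ 2 + (b - x) ^ 2) / 2) / (b - a) := by gcongr
    _ = (1 / 4 + (x - (a + b) / 2) ^ 2 / (b - a) ^ 2) * (b - a) * M := by
      field_simp
      ring
end
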